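/- Let n, m, d be positive integers, let γ_1, …, γ_m be positive integers, and for each i = 1, …, m and j = 1, …, γ_i let g_{i,j} be a convex polynomial on ℝ^n of degree at most d. Set C_i := {x ∈ ℝ^n : g_{i,j}(x) ≤ 0 for j = 1, …, γ_i} and assume C := ⋂_{i=1}^m C_i is nonempty. Let θ > 0 and let K ⊆ ℝ^n be a compact set. Then there exists c > 0 such that for all x ∈ K, dist(x, C)^θ ≤ c·( Σ_{i=1}^m dist(x, C_i)^θ )^τ, where τ := 1/min{((2d−1)^n + 1)/2, β(n−1)·d^n}. -/

import Mathlib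

open Metric Set Filter
open scoped BigOperators

noncomputable section

/-- The restriction of `f` to every line is a polynomial of degree at most `d`. -/
def IsLinePolynomial {E : Type*} [AddCommGroup E] [Module ℝ E] (d : ℕ) (f : E → ℝ) : Prop :=
  ∀ x v : E, ∃ p : Polynomial ℝ, p.natDegree ≤ d ∧ ∀ t : ℝ, f (x + t • v) = p.eval t

theorem IsLinePolynomial.sum {E ι : Type*} [AddCommGroup E] [Module ℝ E] {d : ℕ} {g : ι → E → ℝ}
    (hg : ∀ j, IsLinePolynomial d (g j)) (J : Finset ι) (l : ι → ℝ) :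
    IsLinePolynomial d fun x => ∑ j ∈ J, l j * g j x := by
  intro x v
  choose p hp hpe using fun j => hg j x v
  refine ⟨∑ j ∈ J, Polynomial.C (l j) * p j, ?_, fun t => ?_⟩
  · exact Polynomial.natDegree_sum_le_of_forall_le _ _ fun j _ =>
      (Polynomial.natDegree_C_mul_le _ _).trans (hp j)
  · simp [Polynomial.eval_finsetSum, hpe]

/-- A polynomial of degree at most `d` grows at most like `r ^ d` relative to its bound on
`[0, 1]`. -/
theorem Polynomial.exists_abs_eval_le_of_abs_eval_le (d : ℕ) :
    ∃ C > (0 : ℝ), ∀ p : Polynomial ℝ, p.natDegree ≤ d → ∀ M : ℝ,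
      (∀ t ∈ Icc (0 : ℝ) 1, |p.eval t| ≤ M) → ∀ r : ℝ, 1 ≤ r → |p.eval r| ≤ C * r ^ d * M := by
  set v : ℕ → ℝ := fun k => k / (d + 1) with hv
  set s := Finset.range (d + 1) with hs
  set b : ℕ → Polynomial ℝ := fun k => Lagrange.basis s v k with hb
  have hinj : Set.InjOn v s := by
    intro i _ j _ hij
    have h : (i : ℝ) / (d + 1) = j / (d + 1) := hij
    rw [div_left_inj' (by positivity)] at h
    exact_mod_cast h
  have hbdeg : ∀ k ∈ s, (b k).natDegree ≤ d := by
    intro k hk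
    have := Lagrange.degree_basis hinj hk
    rw [Polynomial.natDegree_le_iff_degree_le]
    exact this.le.trans (by simp [hs])
  refine ⟨1 + ∑ k ∈ s, ∑ i ∈ s, |(b k).coeff i|, by positivity, ?_⟩
  intro p hp M hM r hr
  have hM0 : 0 ≤ M := (abs_nonneg _).trans (hM 0 (by simp))
  have hbr : ∀ k ∈ s, |(b k).eval r| ≤ (∑ i ∈ s, |(b k).coeff i|) * r ^ d := by
    intro k hk
    rw [Polynomial.eval_eq_sum_range' (Nat.lt_succ_of_le (hbdeg k hk)), Finset.sum_mul]
    refine (Finset.abs_sum_le_sum_abs _ _).trans (Finset.sum_le_sum fun i hi => ?_)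
    rw [abs_mul, abs_of_nonneg (a := r ^ i) (by positivity)]
    have : i ≤ d := by simpa [Nat.lt_succ_iff] using hi
    gcongr
  have hint := Lagrange.eq_interpolate (f := p) hinj (by
    rw [hs, Finset.card_range]
    exact (Polynomial.degree_le_of_natDegree_le hp).trans_lt (by exact_mod_cast Nat.lt_succ_self d))
  have hpe : p.eval r = ∑ k ∈ s, p.eval (v k) * (b k).eval r := by
    conv_lhs => rw [hint]
    simp [Lagrange.interpolate_apply, Polynomial.eval_finsetSum, hb]
  rw [hpe]
  calc |∑ k ∈ s, p.eval (v k) * (b k).eval r|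
      ≤ ∑ k ∈ s, |p.eval (v k)| * |(b k).eval r| := by
        simpa only [abs_mul] using
          Finset.abs_sum_le_sum_abs (fun k => p.eval (v k) * (b k).eval r) s
    _ ≤ ∑ k ∈ s, M * ((∑ i ∈ s, |(b k).coeff i|) * r ^ d) := by
        refine Finset.sum_le_sum fun k hk => ?_
        have hk' : k ≤ d := by simpa [hs, Nat.lt_succ_iff] using hk
        have hk'' : (k : ℝ) ≤ d := by exact_mod_cast hk'
        refine mul_le_mul (hM _ ⟨by positivity, ?_⟩) (hbr k hk) (abs_nonneg _) hM0
        rw [hv, div_le_one (by positivity)]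
        linarith
    _ = (∑ k ∈ s, ∑ i ∈ s, |(b k).coeff i|) * r ^ d * M := by
        rw [← Finset.mul_sum, ← Finset.sum_mul]; ring
    _ ≤ _ := by
        gcongr
        linarith

section Convex

variable {E : Type*} [NormedAddCommGroup E] [InnerProductSpace ℝ E]

/-- The zero set in a subspace of a convex polynomial that is nonnegative there and vanishes at
the origin is a subspace. -/
theorem exists_submodule_eq_zero_set {d : ℕ} {h : E → ℝ} (hconv : ConvexOn ℝ univ h)
    (hpoly : IsLinePolynomial d h) (W : Submodule ℝ E) (hnn : ∀ x ∈ W, 0 ≤ h x) (h0 : h 0 = 0) :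
    ∃ V : Submodule ℝ E, ∀ x, x ∈ V ↔ x ∈ W ∧ h x = 0 := by
  have hsmul : ∀ (c : ℝ) (x : E), x ∈ W → h x = 0 → h (c • x) = 0 := by
    intro c x hx hhx
    obtain ⟨p, -, hp⟩ := hpoly 0 x
    have hp0 : p = 0 := by
      refine Polynomial.eq_zero_of_infinite_isRoot p (Set.Infinite.mono (s := Icc 0 1) ?_
        (Icc_infinite one_pos))
      rintro t ⟨ht0, ht1⟩
      have h1 := hconv.2 (mem_univ x) (mem_univ 0) ht0 (sub_nonneg.2 ht1) (by ring)
      have h2 := hnn (t • x) (W.smul_mem t hx)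
      simp only [hhx, h0, smul_zero, add_zero] at h1
      have h3 := hp t
      rw [zero_add] at h3
      exact (h3.symm.trans (le_antisymm h1 h2))
    simpa [hp0] using hp c
  refine ⟨{
    carrier := {x | x ∈ W ∧ h x = 0}
    zero_mem' := ⟨W.zero_mem, h0⟩

    smul_mem' := fun c x hx => ⟨W.smul_mem c hx.1, hsmul c x hx.1 hx.2⟩
    add_mem' := ?_ }, fun x => Iff.rfl⟩
  rintro x y ⟨hx, hhx⟩ ⟨hy, hhy⟩
  refine ⟨W.add_mem hx hy, ?_⟩
  have h1 := hconv.2 (mem_univ x) (mem_univ y) (show (0 : ℝ) ≤ 1 / 2 by norm_num)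
    (show (0 : ℝ) ≤ 1 / 2 by norm_num) (by norm_num)
  have hm : (1 / 2 : ℝ) • x + (1 / 2 : ℝ) • y ∈ W := W.add_mem (W.smul_mem _ hx) (W.smul_mem _ hy)
  simp only [hhx, hhy, smul_zero, add_zero] at h1
  have := hsmul 2 _ hm (le_antisymm h1 (hnn _ hm))
  rwa [show (2 : ℝ) • ((1 / 2 : ℝ) • x + (1 / 2 : ℝ) • y) = x + y by module] at this

theorem ConvexOn.sum_mul {E ι : Type*} [AddCommGroup E] [Module ℝ E] {g : ι → E → ℝ}
    (hg : ∀ j, ConvexOn ℝ univ (g j)) (J : Finset ι) {l : ι → ℝ} (hl : ∀ j, 0 ≤ l j) :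
    ConvexOn ℝ univ fun x => ∑ j ∈ J, l j * g j x := by
  refine ⟨convex_univ, fun x _ y _ a b ha hb hab => ?_⟩
  simp only [smul_eq_mul, Finset.mul_sum, ← Finset.sum_add_distrib]
  refine Finset.sum_le_sum fun j _ => ?_
  have := mul_le_mul_of_nonneg_left ((hg j).2 (mem_univ x) (mem_univ y) ha hb hab) (hl j)
  simp only [smul_eq_mul] at this
  linarith

/-- Theorem of the alternative: if finitely many convex functions have no common strictly negative
point in a subspace, then some nontrivial nonnegative combination is nonnegative there. -/
theorem exists_nonneg_combination {κ : Type*} [Fintype κ] {g : κ → E → ℝ}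
    (hconv : ∀ j, ConvexOn ℝ univ (g j)) (W : Submodule ℝ E)
    (hno : ¬ ∃ x ∈ W, ∀ j, g j x < 0) :
    ∃ l : κ → ℝ, (∀ j, 0 ≤ l j) ∧ (∃ j, 0 < l j) ∧ ∀ x ∈ W, 0 ≤ ∑ j, l j * g j x := by
  classical
  set A : Set (κ → ℝ) := {u | ∃ x ∈ W, ∀ j, g j x < u j} with hA
  have hAconv : Convex ℝ A := by
    rintro u ⟨x, hx, hxu⟩ v ⟨y, hy, hyv⟩ a b ha hb hab
    refine ⟨a • x + b • y, W.add_mem (W.smul_mem a hx) (W.smul_mem b hy), fun j => ?_⟩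
    refine ((hconv j).2 (mem_univ x) (mem_univ y) ha hb hab).trans_lt ?_
    simp only [smul_eq_mul, Pi.add_apply, Pi.smul_apply]
    rcases ha.eq_or_lt with rfl | ha'
    · have : b = 1 := by linarith
      simpa [this] using hyv j
    · have h1 := mul_lt_mul_of_pos_left (hxu j) ha'
      have h2 := mul_le_mul_of_nonneg_left (hyv j).le hb
      linarith
  have hAopen : IsOpen A := by
    have : A = ⋃ x ∈ W, ⋂ j, {u : κ → ℝ | g j x < u j} := by ext; simp [hA]
    rw [this]
    exact isOpen_biUnion fun x _ => isOpen_iInter_of_finite fun j =>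
      isOpen_lt continuous_const (continuous_apply j)
  obtain ⟨f, hf⟩ := geometric_hahn_banach_point_open hAconv hAopen (x := 0)
    fun ⟨x, hx, h⟩ => hno ⟨x, hx, h⟩
  simp only [map_zero] at hf
  set l : κ → ℝ := fun j => f (Pi.single j 1) with hl
  have hfl : ∀ u : κ → ℝ, f u = ∑ j, l j * u j := by
    intro u
    have := LinearMap.pi_apply_eq_sum_univ (f : (κ → ℝ) →ₗ[ℝ] ℝ) u
    simp only [ContinuousLinearMap.coe_coe, smul_eq_mul] at this
    rw [this]
    refine Finset.sum_congr rfl fun j _ => ?_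
    rw [mul_comm, hl]
    congr 2
    ext i
    simp [Pi.single_apply, eq_comm]
  have hmem : ∀ x ∈ W, ∀ t > 0, (fun j => g j x + t) ∈ A := fun x hx t ht =>
    ⟨x, hx, fun j => by linarith⟩
  have hnn : ∀ j, 0 ≤ l j := by
    intro j
    by_contra! hj
    set u : κ → ℝ := fun j => g j 0 + 1 with hu
    have hu0 := hf u (hmem 0 W.zero_mem 1 one_pos)
    have ht : 0 ≤ f u / (-l j) := div_nonneg hu0.le (by linarith)
    have := hf (u + (f u / (-l j)) • Pi.single j 1) ⟨0, W.zero_mem, fun i => by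
      have : 0 ≤ (Pi.single j 1 : κ → ℝ) i := by
        by_cases hij : i = j
        · subst hij; simp
        · simp [hij]
      have := mul_nonneg ht this
      simp only [hu, Pi.add_apply, Pi.smul_apply, smul_eq_mul]
      linarith⟩
    rw [map_add, map_smul, smul_eq_mul, show f (Pi.single j 1) = l j from rfl, div_neg, neg_mul,
      div_mul_cancel₀ _ hj.ne] at this
    linarith
  have hpos : ∃ j, 0 < l j := by
    by_contra! h
    have := hf _ (hmem 0 W.zero_mem 1 one_pos)
    rw [hfl] at this
    refine this.ne' (Finset.sum_eq_zero fun j _ => ?_)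
    rw [le_antisymm (h j) (hnn j), zero_mul]
  refine ⟨l, hnn, hpos, fun x hx => le_of_forall_pos_le_add fun ε hε => ?_⟩
  obtain ⟨i, hi⟩ := hpos
  have hsum : 0 < ∑ j, l j := Finset.sum_pos' (fun j _ => hnn j) ⟨i, Finset.mem_univ i, hi⟩
  have := hf _ (hmem x hx (ε / ∑ j, l j) (by positivity))
  rw [hfl] at this
  simp only [mul_add, Finset.sum_add_distrib, ← Finset.sum_mul] at this
  rw [mul_div_cancel₀ _ hsum.ne'] at this
  exact this.le

/-- A function that respects convex combinations in a subspace and vanishes at the origin is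
linear there. -/
theorem exists_linearMap_eq_on {f : E → ℝ} {W : Submodule ℝ E} (h0 : f 0 = 0)
    (hf : ∀ x ∈ W, ∀ y ∈ W, ∀ a b : ℝ, 0 ≤ a → 0 ≤ b → a + b = 1 →
      f (a • x + b • y) = a * f x + b * f y) :
    ∃ φ : W →ₗ[ℝ] ℝ, ∀ x : W, φ x = f x := by
  have hle : ∀ x ∈ W, ∀ c : ℝ, 0 ≤ c → c ≤ 1 → f (c • x) = c * f x := by
    intro x hx c hc hc1
    simpa [h0] using hf x hx 0 W.zero_mem c (1 - c) hc (by linarith) (by ring)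
  have hnonneg : ∀ x ∈ W, ∀ c : ℝ, 0 ≤ c → f (c • x) = c * f x := by
    intro x hx c hc
    rcases le_total c 1 with hc1 | hc1
    · exact hle x hx c hc hc1
    have hc0 : 0 < c := by linarith
    have := hle (c • x) (W.smul_mem c hx) c⁻¹ (by positivity) (inv_le_one_of_one_le₀ hc1)
    rw [inv_smul_smul₀ hc0.ne'] at this
    rw [this, mul_inv_cancel_left₀ hc0.ne']
  have hadd : ∀ x ∈ W, ∀ y ∈ W, f (x + y) = f x + f y := by
    intro x hx y hy
    have h1 := hf x hx y hy (1 / 2) (1 / 2) (by norm_num) (by norm_num) (by norm_num)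
    have h2 := hnonneg ((1 / 2 : ℝ) • x + (1 / 2 : ℝ) • y)
      (W.add_mem (W.smul_mem _ hx) (W.smul_mem _ hy)) 2 (by norm_num)
    rw [show (2 : ℝ) • ((1 / 2 : ℝ) • x + (1 / 2 : ℝ) • y) = x + y by module, h1] at h2
    linarith
  refine ⟨{ toFun := fun x => f x
            map_add' := fun x y => hadd x x.2 y y.2
            map_smul' := fun c x => ?_ }, fun x => rfl⟩
  simp only [SetLike.val_smul, RingHom.id_apply, smul_eq_mul]
  rcases le_total 0 c with hc | hc
  · exact hnonneg x x.2 c hc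
  · have h1 := hnonneg x x.2 (-c) (by linarith)
    have h2 := hadd (c • (x : E)) (W.smul_mem c x.2) ((-c) • (x : E)) (W.smul_mem _ x.2)
    rw [show c • (x : E) + (-c) • (x : E) = 0 by module, h0, h1] at h2
    linarith


/-- The sublevel system `g j ≤ 0` restricted to the subspace `W` admits, on the ball of radius `R`,
a Hölder error bound of order `N`. -/
def HasErrorBound {ι : Type*} (g : ι → E → ℝ) (R : ℝ) (W : Submodule ℝ E) (N : ℕ) : Prop :=
  ∃ c > (0 : ℝ), ∀ x ∈ W, ‖x‖ ≤ R → ∀ δ : ℝ, 0 ≤ δ → (∀ j, g j x ≤ δ ^ N) →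
    ∃ y ∈ W, (∀ j, g j y ≤ 0) ∧ ‖x - y‖ ≤ c * δ

theorem HasErrorBound.of_le_one {ι : Type*} {g : ι → E → ℝ} (h0 : ∀ j, g j 0 ≤ 0) {R : ℝ}
    {W : Submodule ℝ E} {N : ℕ} {c : ℝ} (hc : 0 < c)
    (h : ∀ x ∈ W, ‖x‖ ≤ R → ∀ δ : ℝ, 0 ≤ δ → δ ≤ 1 → (∀ j, g j x ≤ δ ^ N) →
      ∃ y ∈ W, (∀ j, g j y ≤ 0) ∧ ‖x - y‖ ≤ c * δ) :
    HasErrorBound g R W N := by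
  refine ⟨max c R, lt_max_of_lt_left hc, fun x hx hxR δ hδ hg => ?_⟩
  rcases le_total δ 1 with h1 | h1
  · obtain ⟨y, hy, hgy, hxy⟩ := h x hx hxR δ hδ h1 hg
    exact ⟨y, hy, hgy, hxy.trans (by gcongr; exact le_max_left _ _)⟩
  · refine ⟨0, W.zero_mem, h0, ?_⟩
    rw [sub_zero]
    have : R ≤ max c R := le_max_right _ _
    have : 0 < max c R := lt_max_of_lt_left hc
    nlinarith

/-- A strictly feasible point yields a Lipschitz error bound. -/
theorem HasErrorBound.of_slater {ι : Type*} [Finite ι] {g : ι → E → ℝ}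
    (hconv : ∀ j, ConvexOn ℝ univ (g j)) (h0 : ∀ j, g j 0 ≤ 0) {R : ℝ} (hR : 0 < R)
    {W : Submodule ℝ E} {N : ℕ} (hN : N ≠ 0) {s : E} (hs : s ∈ W)
    (hsl : ∀ j, g j s < 0 ∨ ∀ x ∈ W, g j x = 0) :
    HasErrorBound g R W N := by
  obtain ⟨η, hη, hgη⟩ : ∃ η > (0 : ℝ), ∀ j, g j s ≤ -η ∨ ∀ x ∈ W, g j x = 0 := by
    have : ∀ᶠ η in nhdsWithin (0 : ℝ) (Ioi 0), ∀ j, g j s ≤ -η ∨ ∀ x ∈ W, g j x = 0 := by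
      refine eventually_all.2 fun j => ?_
      rcases hsl j with h | h
      · filter_upwards [Ioo_mem_nhdsGT (neg_pos.2 h)] with η hη
        exact Or.inl (by linarith [hη.2])
      · exact Eventually.of_forall fun _ => Or.inr h
    obtain ⟨η, h1, h2⟩ := (this.and self_mem_nhdsWithin).exists
    exact ⟨η, h2, h1⟩
  refine HasErrorBound.of_le_one (c := (R + ‖s‖) / η) h0 (by positivity)
    fun x hx hxR δ hδ hδ1 hg => ?_
  set ε := δ ^ N with hε
  have hε0 : 0 ≤ ε := by positivity
  have hεδ : ε ≤ δ := pow_le_of_le_one hδ hδ1 hN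
  have hsum : 0 < ε + η := by positivity
  set a := η / (ε + η) with ha
  set b := ε / (ε + η) with hb
  have hab : a + b = 1 := by rw [ha, hb, ← add_div, add_comm η, div_self hsum.ne']
  refine ⟨a • x + b • s, W.add_mem (W.smul_mem _ hx) (W.smul_mem _ hs), fun j => ?_, ?_⟩
  · rcases hgη j with h | h
    · refine ((hconv j).2 (mem_univ x) (mem_univ s) (by positivity) (by positivity) hab).trans ?_
      have h1 : a * g j x ≤ a * ε := by gcongr; exact hg j
      have h2 : b * g j s ≤ b * (-η) := by gcongr
      have h3 : a * ε + b * (-η) = 0 := by rw [ha, hb]; ring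
      simp only [smul_eq_mul]
      linarith
    · exact (h _ (W.add_mem (W.smul_mem _ hx) (W.smul_mem _ hs))).le
  · have : x - (a • x + b • s) = b • (x - s) := by
      rw [show a = 1 - b by linarith]; module
    rw [this, norm_smul, Real.norm_of_nonneg (by positivity)]
    have h1 : ‖x - s‖ ≤ R + ‖s‖ := (norm_sub_le _ _).trans (by linarith)
    have h2 : b ≤ δ / η := by
      rw [hb]
      gcongr
      linarith
    calc b * ‖x - s‖ ≤ δ / η * (R + ‖s‖) := by gcongr
      _ = _ := by ring

/-- If a nonnegative combination of convex functions vanishes identically on a subspace, then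
each function with positive weight respects convex combinations there. -/
theorem eq_combo_of_sum_eq_zero {κ : Type*} [Fintype κ] {g : κ → E → ℝ}
    (hconv : ∀ j, ConvexOn ℝ univ (g j)) {W : Submodule ℝ E} {l : κ → ℝ} (hl : ∀ j, 0 ≤ l j)
    (hsum : ∀ x ∈ W, ∑ j, l j * g j x = 0) {i : κ} (hi : 0 < l i) {x y : E} (hx : x ∈ W)
    (hy : y ∈ W) {a b : ℝ} (ha : 0 ≤ a) (hb : 0 ≤ b) (hab : a + b = 1) :
    g i (a • x + b • y) = a * g i x + b * g i y := by
  have hnn : ∀ j, 0 ≤ l j * (a * g j x + b * g j y - g j (a • x + b • y)) := fun j =>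
    mul_nonneg (hl j) (sub_nonneg.2 ((hconv j).2 (mem_univ x) (mem_univ y) ha hb hab))
  have hs : ∑ j, l j * (a * g j x + b * g j y - g j (a • x + b • y)) = 0 := by
    have h1 := hsum x hx
    have h2 := hsum y hy
    have h3 := hsum _ (W.add_mem (W.smul_mem a hx) (W.smul_mem b hy))
    calc _ = a * ∑ j, l j * g j x + b * ∑ j, l j * g j y - ∑ j, l j * g j (a • x + b • y) := by
          rw [Finset.mul_sum, Finset.mul_sum, ← Finset.sum_add_distrib, ← Finset.sum_sub_distrib]
          exact Finset.sum_congr rfl fun j _ => by ring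
      _ = 0 := by rw [h1, h2, h3]; ring
  have := (Finset.sum_eq_zero_iff_of_nonneg fun j _ => hnn j).1 hs i (Finset.mem_univ i)
  rcases mul_eq_zero.1 this with h | h <;> linarith

/-- If a combination of the `g j` vanishes identically on `W` while some `g i` of positive weight
does not, near-feasible points are linearly close to the proper subspace `{g i = 0}`. -/
theorem exists_submodule_of_sum_eq_zero {κ : Type*} [Fintype κ] {g : κ → E → ℝ}
    (hconv : ∀ j, ConvexOn ℝ univ (g j)) (h0 : ∀ j, g j 0 ≤ 0) {W : Submodule ℝ E} {l : κ → ℝ}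
    (hl : ∀ j, 0 ≤ l j) (hsum : ∀ x ∈ W, ∑ j, l j * g j x = 0) {i : κ} (hi : 0 < l i)
    {w : E} (hw : w ∈ W) (hgw : g i w ≠ 0) :
    ∃ V < W, ∃ c > (0 : ℝ), ∀ x ∈ W, ∀ ε : ℝ, 0 ≤ ε → (∀ j, g j x ≤ ε) →
      ∃ z ∈ V, ‖x - z‖ ≤ c * ε := by
  have hi0 : g i 0 = 0 := by
    have h1 : ∑ j, l j * -g j 0 = 0 := by
      simpa only [mul_neg, Finset.sum_neg_distrib, neg_eq_zero] using hsum 0 W.zero_mem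
    have h2 := (Finset.sum_eq_zero_iff_of_nonneg fun j _ =>
      mul_nonneg (hl j) (neg_nonneg.2 (h0 j))).1 h1 i (Finset.mem_univ i)
    rcases mul_eq_zero.1 h2 with h | h <;> linarith
  obtain ⟨φ, hφ⟩ := exists_linearMap_eq_on (W := W) hi0 fun x hx y hy a b ha hb hab =>
    eq_combo_of_sum_eq_zero hconv hl hsum hi hx hy ha hb hab
  have hwφ : φ ⟨w, hw⟩ ≠ 0 := by rwa [hφ]
  refine ⟨φ.ker.map W.subtype, ?_, (1 + (∑ j, l j) / l i) / |g i w| * ‖w‖ + 1, ?_, ?_⟩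
  · refine lt_of_le_of_ne (Submodule.map_subtype_le _ _) fun h => ?_
    have hw' := hw
    rw [← h] at hw'
    obtain ⟨v, hv, hvw⟩ := hw'
    have : v = ⟨w, hw⟩ := Subtype.ext hvw
    exact hwφ (this ▸ hv)
  · have : 0 ≤ ∑ j, l j := Finset.sum_nonneg fun j _ => hl j
    positivity
  intro x hx ε hε hg
  have hs : ∑ j, l j * (ε - g j x) = (∑ j, l j) * ε := by
    simp only [mul_sub, Finset.sum_sub_distrib, hsum x hx, sub_zero, Finset.sum_mul]
  have h1 : l i * (ε - g i x) ≤ (∑ j, l j) * ε := by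
    rw [← hs]
    exact Finset.single_le_sum (f := fun j => l j * (ε - g j x))
      (fun j _ => mul_nonneg (hl j) (sub_nonneg.2 (hg j))) (Finset.mem_univ i)
  have h2 : ε - g i x ≤ (∑ j, l j) / l i * ε := by
    rw [div_mul_eq_mul_div, le_div_iff₀ hi]; linarith
  have h3 : 0 ≤ (∑ j, l j) / l i * ε := by
    linarith [hg i]
  have habs : |g i x| ≤ (1 + (∑ j, l j) / l i) * ε := by
    rw [abs_le]
    constructor <;> linarith [hg i]
  refine ⟨x - (g i x / g i w) • w, ⟨⟨x, hx⟩ - (g i x / g i w) • ⟨w, hw⟩, ?_, rfl⟩, ?_⟩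
  · rw [SetLike.mem_coe, LinearMap.mem_ker, map_sub, map_smul, hφ, hφ, smul_eq_mul,
      div_mul_cancel₀ _ hgw, sub_self]
  · rw [sub_sub_cancel, norm_smul, norm_div, Real.norm_eq_abs, Real.norm_eq_abs]
    calc |g i x| / |g i w| * ‖w‖ ≤ (1 + (∑ j, l j) / l i) * ε / |g i w| * ‖w‖ := by gcongr
      _ ≤ ((1 + (∑ j, l j) / l i) / |g i w| * ‖w‖ + 1) * ε := by
        rw [add_mul _ 1, one_mul, mul_div_right_comm, mul_right_comm]
        linarith

end Convex

section FiniteDimensional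

variable {E : Type*} [NormedAddCommGroup E] [InnerProductSpace ℝ E] [FiniteDimensional ℝ E]

theorem ConvexOn.exists_lipschitz_on_ball {f : E → ℝ} (hf : ConvexOn ℝ univ f) (R : ℝ) :
    ∃ L ≥ (0 : ℝ), ∀ x y : E, ‖x‖ ≤ R → ‖y‖ ≤ R → f x ≤ f y + L * ‖x - y‖ := by
  have hcont : Continuous f := hf.locallyLipschitz.continuous
  have hbdd : Bornology.IsBounded (f '' ball (0 : E) (R + 2)) :=
    (((isCompact_closedBall (0 : E) (R + 2)).image hcont).isBounded).subset
      (image_mono ball_subset_closedBall)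
  obtain ⟨L, hL⟩ := (hf.subset (subset_univ _) (convex_ball (0 : E) (R + 2))
    ).exists_lipschitzOnWith_of_isBounded (r' := R + 1) (by linarith) hbdd
  refine ⟨L, L.2, fun x y hx hy => ?_⟩
  have := hL.dist_le_mul x (by simp; linarith) y (by simp; linarith)
  rw [Real.dist_eq, dist_eq_norm] at this
  linarith [le_abs_self (f x - f y)]

/-- Error bound of exponent `d` for a single nonnegative convex polynomial. -/
theorem exists_error_bound_of_nonneg {d : ℕ} {h : E → ℝ} (hconv : ConvexOn ℝ univ h)
    (hpoly : IsLinePolynomial d h) (W V : Submodule ℝ E) (hnn : ∀ x ∈ W, 0 ≤ h x)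
    (hV : ∀ x, x ∈ V ↔ x ∈ W ∧ h x = 0) {R : ℝ} (hR : 0 < R) (hd : 0 < d) :
    ∃ c > (0 : ℝ), ∀ x ∈ W, ‖x‖ ≤ R → ∃ z ∈ V, ‖x - z‖ ^ d ≤ c * h x := by
  have hcont : Continuous h := hconv.locallyLipschitz.continuous
  have hVW : V ≤ W := fun x hx => ((hV x).1 hx).1
  obtain ⟨C, hC, hgrow⟩ := Polynomial.exists_abs_eval_le_of_abs_eval_le d
  set S : Set E := closedBall 0 (2 * R) ∩ ((W : Set E) ∩ {y | ‖y - V.starProjection y‖ = R})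
  have hS : IsCompact S := (isCompact_closedBall 0 (2 * R)).inter_right
    (W.closed_of_finiteDimensional.inter (isClosed_eq (by fun_prop) continuous_const))
  obtain ⟨m, hm, hmS⟩ := hS.exists_forall_le' (f := h) hcont.continuousOn (a := 0) (by
    rintro y ⟨-, hyW, hyR⟩
    refine lt_of_le_of_ne (hnn y hyW) fun h0 => hR.ne ?_
    have : y ∈ V := (hV y).2 ⟨hyW, h0.symm⟩
    rw [← hyR, V.starProjection_eq_self_iff.2 this]
    simp)
  refine ⟨C * R ^ d / m, by positivity, fun x hx hxR => ?_⟩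
  set z := V.starProjection x with hz
  have hzV : z ∈ V := V.starProjection_apply_mem x
  have hzR : ‖z‖ ≤ R := (V.norm_starProjection_apply_le x).trans hxR
  refine ⟨z, hzV, ?_⟩
  set δ := ‖x - z‖ with hδ
  have hhz : h z = 0 := ((hV z).1 hzV).2
  rcases (norm_nonneg (x - z)).eq_or_lt with h0 | hδ0
  · rw [hδ, ← h0, zero_pow hd.ne']
    exact mul_nonneg (by positivity) (hnn x hx)
  rw [← hδ] at hδ0
  have hδR : δ ≤ R := by
    have := Submodule.norm_sq_eq_add_norm_sq_starProjection x V
    rw [V.starProjection_orthogonal_val x] at this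
    nlinarith [norm_nonneg x, norm_nonneg z, sq_nonneg ‖V.starProjection x‖]
  obtain ⟨p, hpd, hp⟩ := hpoly z (x - z)
  have hp1 : p.eval 1 = h x := by rw [← hp 1]; simp
  have hbd : ∀ t ∈ Icc (0 : ℝ) 1, |p.eval t| ≤ h x := by
    rintro t ⟨ht0, ht1⟩
    rw [← hp t, abs_of_nonneg (hnn _ (W.add_mem (hVW hzV)
      (W.smul_mem t (W.sub_mem hx (hVW hzV)))))]
    have h1 := hconv.2 (mem_univ x) (mem_univ z) ht0 (sub_nonneg.2 ht1) (by ring)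
    rw [show t • x + (1 - t) • z = z + t • (x - z) by module, hhz] at h1
    have := hnn x hx
    simp only [smul_eq_mul] at h1
    nlinarith
  have hfar := hgrow p hpd _ hbd (R / δ) ((one_le_div hδ0).2 hδR)
  rw [← hp] at hfar
  have hmem : z + (R / δ) • (x - z) ∈ S := by
    have hn : ‖(R / δ) • (x - z)‖ = R := by
      rw [norm_smul, Real.norm_of_nonneg (by positivity), ← hδ, div_mul_cancel₀ _ hδ0.ne']
    refine ⟨?_, W.add_mem (hVW hzV) (W.smul_mem _ (W.sub_mem hx (hVW hzV))), ?_⟩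
    · rw [mem_closedBall_zero_iff]
      exact (norm_add_le _ _).trans (by linarith)
    · have hzz : V.starProjection z = z := V.starProjection_eq_self_iff.2 hzV
      have : V.starProjection (z + (R / δ) • (x - z)) = z := by
        rw [map_add, map_smul, map_sub, hzz, ← hz, sub_self, smul_zero, add_zero]
      rw [mem_ofPred_eq, this, add_sub_cancel_left, hn]
  have h2 : m ≤ C * (R / δ) ^ d * h x := (hmS _ hmem).trans ((le_abs_self _).trans hfar)
  rw [div_pow] at h2
  have hδd : 0 < δ ^ d := by positivity
  rw [div_mul_eq_mul_div, le_div_iff₀ hm]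
  calc δ ^ d * m ≤ δ ^ d * (C * (R ^ d / δ ^ d) * h x) := by gcongr
    _ = C * R ^ d * h x := by field_simp

/-- An error bound on a smaller subspace transfers to a larger one, provided near-feasible points
are close to the smaller subspace. -/
theorem HasErrorBound.of_le {ι : Type*} [Finite ι] {g : ι → E → ℝ}
    (hconv : ∀ j, ConvexOn ℝ univ (g j)) (h0 : ∀ j, g j 0 ≤ 0) {R : ℝ}
    {V W : Submodule ℝ E} (hVW : V ≤ W) {M N : ℕ} (hM : M ≠ 0) (hMN : M ≤ N)
    (hV : HasErrorBound g R V M) {c : ℝ} (hc : 0 < c)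
    (hclose : ∀ x ∈ W, ‖x‖ ≤ R → ∀ δ : ℝ, 0 ≤ δ → δ ≤ 1 → (∀ j, g j x ≤ δ ^ N) →
      ∃ z ∈ V, ‖x - z‖ ≤ c * δ ^ M) :
    HasErrorBound g R W N := by
  have := Fintype.ofFinite ι
  choose L hL0 hL using fun j => (hconv j).exists_lipschitz_on_ball R
  obtain ⟨k, hk, hVk⟩ := hV
  have hLs : 0 ≤ ∑ j, L j := Finset.sum_nonneg fun j _ => hL0 j
  set D := 1 + (∑ j, L j) * c with hD
  have hD1 : 1 ≤ D := by rw [hD]; linarith [mul_nonneg hLs hc.le]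
  refine HasErrorBound.of_le_one (c := c + k * D) h0 (by positivity)
    fun x hx hxR δ hδ hδ1 hg => ?_
  obtain ⟨z', hz'V, hz'⟩ := hclose x hx hxR δ hδ hδ1 hg
  set z := V.starProjection x
  have hzV : z ∈ V := V.starProjection_apply_mem x
  have hzR : ‖z‖ ≤ R := (V.norm_starProjection_apply_le x).trans hxR
  have hxz : ‖x - z‖ ≤ c * δ ^ M := by
    rw [V.starProjection_minimal]
    exact (ciInf_le ⟨0, by rintro _ ⟨w, rfl⟩; positivity⟩ (⟨z', hz'V⟩ : V)).trans hz'
  have hgz : ∀ j, g j z ≤ (D * δ) ^ M := by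
    intro j
    have h1 := hL j z x hzR hxR
    rw [norm_sub_rev] at h1
    have h2 : L j * ‖x - z‖ ≤ (∑ j, L j) * (c * δ ^ M) := by
      gcongr
      exact Finset.single_le_sum (fun i _ => hL0 i) (Finset.mem_univ j)
    have h3 : δ ^ N ≤ δ ^ M := pow_le_pow_of_le_one hδ hδ1 hMN
    have h4 := hg j
    have h5 : D * δ ^ M ≤ (D * δ) ^ M := by
      rw [mul_pow]
      gcongr
      exact le_self_pow₀ hD1 hM
    calc g j z ≤ δ ^ M + (∑ j, L j) * (c * δ ^ M) := by linarith
      _ = D * δ ^ M := by rw [hD]; ring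
      _ ≤ _ := h5
  obtain ⟨y, hyV, hgy, hzy⟩ := hVk z hzV hzR (D * δ) (by positivity) hgz
  refine ⟨y, hVW hyV, hgy, ?_⟩
  have hδM : δ ^ M ≤ δ := pow_le_of_le_one hδ hδ1 hM
  calc ‖x - y‖ ≤ ‖x - z‖ + ‖z - y‖ := norm_sub_le_norm_sub_add_norm_sub _ _ _
    _ ≤ c * δ + k * (D * δ) := add_le_add (hxz.trans (by gcongr)) hzy
    _ = _ := by ring

/-- Hölder error bound for a convex polynomial system, with exponent `1 / d ^ r` on an
`r`-dimensional subspace. -/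
theorem hasErrorBound_of_finrank_le {ι : Type*} [Finite ι] {d : ℕ} (hd : 0 < d) {g : ι → E → ℝ}
    (hconv : ∀ j, ConvexOn ℝ univ (g j)) (hpoly : ∀ j, IsLinePolynomial d (g j))
    (h0 : ∀ j, g j 0 ≤ 0) {R : ℝ} (hR : 0 < R) (r : ℕ) (W : Submodule ℝ E)
    (hW : Module.finrank ℝ W ≤ r) : HasErrorBound g R W (d ^ r) := by
  classical
  induction r generalizing W with
  | zero =>
    have hW0 : W = ⊥ := Submodule.finrank_eq_zero.1 (Nat.le_zero.1 hW)
    refine ⟨1, one_pos, fun x hx _ δ hδ _ => ⟨x, hx, ?_, by simpa using hδ⟩⟩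
    rw [hW0, Submodule.mem_bot] at hx
    rwa [hx]
  | succ r ih =>
    have := Fintype.ofFinite ι
    have hdr : d ^ r ≠ 0 := (pow_pos hd r).ne'
    have hle : d ^ r ≤ d ^ (r + 1) := Nat.pow_le_pow_right hd (Nat.le_succ r)
    have ihV : ∀ V : Submodule ℝ E, V < W → HasErrorBound g R V (d ^ r) := fun V hV =>
      ih V (Nat.le_of_lt_succ ((Submodule.finrank_lt_finrank_of_lt hV).trans_le hW))
    let κ := {j // ∃ x ∈ W, g j x ≠ 0}
    by_cases hsl : ∃ s ∈ W, ∀ j : κ, g j s < 0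
    · obtain ⟨s, hs, hgs⟩ := hsl
      refine HasErrorBound.of_slater hconv h0 hR (pow_pos hd _).ne' hs fun j => ?_
      by_cases hj : ∃ x ∈ W, g j x ≠ 0
      · exact Or.inl (hgs ⟨j, hj⟩)
      · exact Or.inr (by simpa using hj)
    obtain ⟨l, hl, ⟨i, hi⟩, hnn⟩ :=
      exists_nonneg_combination (fun j : κ => hconv j) W hsl
    by_cases hzero : ∀ x ∈ W, ∑ j : κ, l j * g j x = 0
    · obtain ⟨w, hw, hgw⟩ := i.2
      obtain ⟨V, hV, c, hc, hclose⟩ := exists_submodule_of_sum_eq_zero (fun j : κ => hconv j)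
        (fun j => h0 j) hl hzero hi hw hgw
      refine HasErrorBound.of_le hconv h0 hV.le hdr hle (ihV V hV) hc
        fun x hx _ δ hδ hδ1 hg => ?_
      exact hclose x hx (δ ^ d ^ r) (by positivity) fun j =>
        (hg j).trans (pow_le_pow_of_le_one hδ hδ1 hle)
    push Not at hzero
    obtain ⟨w, hw, hhw⟩ := hzero
    set h : E → ℝ := fun x => ∑ j : κ, l j * g j x with hh
    have hhconv : ConvexOn ℝ univ h := ConvexOn.sum_mul (fun j : κ => hconv j) _ hl
    have hhpoly : IsLinePolynomial d h := IsLinePolynomial.sum (fun j : κ => hpoly j) _ l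
    have hh0 : h 0 = 0 := le_antisymm
      (Finset.sum_nonpos fun j _ => mul_nonpos_of_nonneg_of_nonpos (hl j) (h0 j))
      (hnn 0 W.zero_mem)
    obtain ⟨V, hVmem⟩ := exists_submodule_eq_zero_set hhconv hhpoly W hnn hh0
    have hVW : V < W := by
      refine lt_of_le_of_ne (fun x hx => ((hVmem x).1 hx).1) fun heq => hhw ?_
      exact ((hVmem w).1 (heq ▸ hw)).2
    obtain ⟨c, hc, hbound⟩ := exists_error_bound_of_nonneg hhconv hhpoly W V hnn hVmem hR hd
    have hls : 0 ≤ ∑ j, l j := Finset.sum_nonneg fun j _ => hl j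
    set D := 1 + c * ∑ j, l j with hD
    have hD1 : 1 ≤ D := by rw [hD]; linarith [mul_nonneg hc.le hls]
    refine HasErrorBound.of_le hconv h0 hVW.le hdr hle (ihV V hVW) (c := D) (by linarith)
      fun x hx hxR δ hδ hδ1 hg => ?_
    obtain ⟨z, hz, hxz⟩ := hbound x hx hxR
    refine ⟨z, hz, le_of_pow_le_pow_left₀ hd.ne' (by positivity) (hxz.trans ?_)⟩
    have hhx : h x ≤ (∑ j, l j) * δ ^ d ^ (r + 1) := by
      rw [hh, Finset.sum_mul]
      exact Finset.sum_le_sum fun j _ => mul_le_mul_of_nonneg_left (hg j) (hl j)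
    calc c * h x ≤ c * ((∑ j, l j) * δ ^ d ^ (r + 1)) := by gcongr
      _ = (c * ∑ j, l j) * (δ ^ d ^ r) ^ d := by rw [← pow_mul, ← pow_succ]; ring
      _ ≤ D ^ d * (δ ^ d ^ r) ^ d := by
        gcongr
        exact (by rw [hD]; linarith : c * ∑ j, l j ≤ D).trans (le_self_pow₀ hD1 hd.ne')
      _ = (D * δ ^ d ^ r) ^ d := by rw [mul_pow]

end FiniteDimensional

theorem MvPolynomial.isLinePolynomial_eval {n d : ℕ} {p : MvPolynomial (Fin n) ℝ}
    (hp : p.totalDegree ≤ d) :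
    IsLinePolynomial d fun x : EuclideanSpace ℝ (Fin n) => MvPolynomial.eval (fun t => x t) p := by
  intro x v
  refine ⟨MvPolynomial.aeval (fun i => Polynomial.C (v i) * Polynomial.X + Polynomial.C (x i)) p,
    ?_, fun t => ?_⟩
  · simpa using MvPolynomial.aeval_natDegree_le p hp _ fun i => Polynomial.natDegree_linear_le
  · clear hp
    induction p using MvPolynomial.induction_on with
    | C r => simp
    | add p q hp hq => simp only [map_add, Polynomial.eval_add, hp, hq]
    | mul_X p i hp =>
      simp only [map_mul, Polynomial.eval_mul, hp, MvPolynomial.eval_X, MvPolynomial.aeval_X]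
      simp [mul_comm t, add_comm (x i)]

/-- Near a compact set, being `δ ^ (d ^ n)`-close to each basic semialgebraic convex set forces
being `O(δ)`-close to their intersection. -/
theorem exists_infDist_iInter_le {n m d : ℕ} (hd : 0 < d) {γ : Fin m → ℕ}
    {g : (i : Fin m) → Fin (γ i) → EuclideanSpace ℝ (Fin n) → ℝ}
    (hpoly : ∀ i j, IsLinePolynomial d (g i j))
    (hconv : ∀ i j, ConvexOn ℝ Set.univ (g i j))
    {C : Fin m → Set (EuclideanSpace ℝ (Fin n))} (hC : ∀ i, C i = {x | ∀ j, g i j x ≤ 0})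
    {a : EuclideanSpace ℝ (Fin n)} (ha : ∀ i, a ∈ C i) {R : ℝ} (hR : 0 < R) :
    ∃ c > (0 : ℝ), ∀ x, ‖x - a‖ ≤ R → ∀ δ : ℝ, 0 ≤ δ →
      (∀ i, infDist x (C i) ≤ δ ^ d ^ n) → infDist x (⋂ i, C i) ≤ c * δ := by
  set G : (Σ i, Fin (γ i)) → EuclideanSpace ℝ (Fin n) → ℝ := fun k x => g k.1 k.2 (a + x)
  have hGconv : ∀ k, ConvexOn ℝ univ (G k) := fun k => by
    simpa [Function.comp_def] using (hconv k.1 k.2).translate_right a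
  have hGpoly : ∀ k, IsLinePolynomial d (G k) := fun k x v => by
    simpa [G, add_assoc] using hpoly k.1 k.2 (a + x) v
  have hG0 : ∀ k, G k 0 ≤ 0 := fun k => by
    have := ha k.1
    rw [hC] at this
    simpa [G] using this k.2
  have hCcl : ∀ i, IsClosed (C i) := fun i => by
    rw [hC, ofPred_forall]
    exact isClosed_iInter fun j =>
      isClosed_le (hconv i j).locallyLipschitz.continuous continuous_const
  choose L hL0 hL using fun k => (hGconv k).exists_lipschitz_on_ball (2 * R)
  obtain ⟨c, hc, hbound⟩ := hasErrorBound_of_finrank_le hd hGconv hGpoly hG0 hR n ⊤ (by simp)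
  have hLs : 0 ≤ ∑ k, L k := Finset.sum_nonneg fun k _ => hL0 k
  refine ⟨c * (1 + ∑ k, L k), by positivity, fun x hx δ hδ hdist => ?_⟩
  have hN : d ^ n ≠ 0 := (pow_pos hd n).ne'
  have hG : ∀ k, G k (x - a) ≤ ((1 + ∑ k, L k) * δ) ^ d ^ n := by
    intro k
    obtain ⟨y, hy, hxy⟩ := (hCcl k.1).exists_infDist_eq_dist ⟨a, ha k.1⟩ x
    have hya : ‖y - a‖ ≤ 2 * R := by
      have h1 : dist x y ≤ dist x a := hxy ▸ infDist_le_dist_of_mem (ha k.1)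
      rw [dist_eq_norm, dist_eq_norm] at h1
      have := norm_sub_le_norm_sub_add_norm_sub y x a
      rw [norm_sub_rev y x] at this
      linarith
    have hgy : G k (y - a) ≤ 0 := by
      rw [hC] at hy
      simpa [G] using hy k.2
    have h2 := hL k (x - a) (y - a) (by linarith) hya
    rw [sub_sub_sub_cancel_right, ← dist_eq_norm, ← hxy] at h2
    calc G k (x - a) ≤ L k * infDist x (C k.1) := by linarith
      _ ≤ (∑ k, L k) * δ ^ d ^ n := by
        gcongr
        · exact infDist_nonneg
        · exact Finset.single_le_sum (fun k _ => hL0 k) (Finset.mem_univ k)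
        · exact hdist k.1
      _ ≤ (1 + ∑ k, L k) ^ d ^ n * δ ^ d ^ n := by
        gcongr
        exact (by linarith : ∑ k, L k ≤ 1 + ∑ k, L k).trans (le_self_pow₀ (by linarith) hN)
      _ = _ := by rw [mul_pow]
  obtain ⟨y, -, hy, hxy⟩ := hbound (x - a) trivial hx _ (by positivity) hG
  have hmem : a + y ∈ ⋂ i, C i := by
    refine mem_iInter.2 fun i => ?_
    rw [hC]
    exact fun j => hy ⟨i, j⟩
  refine (infDist_le_dist_of_mem hmem).trans ?_
  rw [dist_eq_norm, ← sub_sub, mul_assoc]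
  exact hxy

theorem pow_le_min_effective_exponent {n d : ℕ} (hd : 0 < d) :
    (d : ℝ) ^ n ≤ min (((2 * (d : ℝ) - 1) ^ n + 1) / 2)
      ((Nat.choose (n - 1) ((n - 1) / 2) : ℝ) * (d : ℝ) ^ n) := by
  have hd1 : (1 : ℝ) ≤ d := by exact_mod_cast hd
  refine le_min ?_ ?_
  · have := (convexOn_pow n).2 (x := 2 * (d : ℝ) - 1) (y := 1) (mem_Ici.2 (by linarith))
      (mem_Ici.2 zero_le_one) (show (0 : ℝ) ≤ 1 / 2 by norm_num)
      (show (0 : ℝ) ≤ 1 / 2 by norm_num) (by norm_num)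
    simp only [smul_eq_mul, one_pow] at this
    rw [show (1 / 2 : ℝ) * (2 * d - 1) + 1 / 2 * 1 = d by ring] at this
    linarith
  · have : (1 : ℝ) ≤ Nat.choose (n - 1) ((n - 1) / 2) := by
      exact_mod_cast Nat.choose_pos (Nat.div_le_self _ _)
    exact le_mul_of_one_le_left (by positivity) this

/-- Hölderian regularity for finitely many basic semi-algebraic convex sets
(Theorem 3.4). -/
theorem holderian_regularity_basic_semialgebraic_convex
    (n m d : ℕ) (hn : 0 < n) (hm : 0 < m) (hd : 0 < d)
    (γ : Fin m → ℕ) (hγ : ∀ i, 0 < γ i)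
    (g : (i : Fin m) → Fin (γ i) → EuclideanSpace ℝ (Fin n) → ℝ)
    (hpoly : ∀ i j, ∃ p : MvPolynomial (Fin n) ℝ, p.totalDegree ≤ d ∧
      ∀ x : EuclideanSpace ℝ (Fin n), g i j x = MvPolynomial.eval (fun t => x t) p)
    (hconv : ∀ i j, ConvexOn ℝ Set.univ (g i j))
    (C : Fin m → Set (EuclideanSpace ℝ (Fin n)))
    (hC : ∀ i, C i = {x | ∀ j, g i j x ≤ 0})
    (hne : (⋂ i, C i).Nonempty)
    (θ : ℝ) (hθ : 0 < θ)
    (K : Set (EuclideanSpace ℝ (Fin n))) (hK : IsCompact K)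
    (τ : ℝ)
    (hτ : τ = 1 / min (((2 * (d : ℝ) - 1) ^ n + 1) / 2)
                      ((Nat.choose (n - 1) ((n - 1) / 2) : ℝ) * (d : ℝ) ^ n)) :
    ∃ c > (0 : ℝ), ∀ x ∈ K,
      Metric.infDist x (⋂ i, C i) ^ θ ≤ c * (∑ i, Metric.infDist x (C i) ^ θ) ^ τ := by
  obtain ⟨a, ha⟩ := hne
  have haC := mem_iInter.1 ha
  obtain ⟨R, hR, hKR⟩ : ∃ R > 0, ∀ x ∈ K, ‖x - a‖ ≤ R := by
    obtain ⟨R, hR⟩ := hK.isBounded.subset_closedBall a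
    refine ⟨max R 1, by positivity, fun x hx => ?_⟩
    rw [← dist_eq_norm]
    exact (mem_closedBall.1 (hR hx)).trans (le_max_left _ _)
  have hline : ∀ i j, IsLinePolynomial d (g i j) := fun i j => by
    obtain ⟨p, hp, hgp⟩ := hpoly i j
    rw [funext hgp]
    exact MvPolynomial.isLinePolynomial_eval hp
  obtain ⟨c, hc, hbound⟩ := exists_infDist_iInter_le hd hline hconv hC haC hR
  have hN : (0 : ℝ) < (d : ℝ) ^ n := by positivity
  have hNmin := pow_le_min_effective_exponent (n := n) hd
  have hτ0 : 0 < τ := by rw [hτ]; exact one_div_pos.2 (hN.trans_le hNmin)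
  have hτN : τ ≤ 1 / (d : ℝ) ^ n := by rw [hτ]; exact one_div_le_one_div_of_le hN hNmin
  have hmR : (0 : ℝ) < m * R ^ θ := by positivity
  refine ⟨c ^ θ * (m * R ^ θ) ^ (1 / (d : ℝ) ^ n - τ), by positivity, fun x hx => ?_⟩
  set s := ∑ i, infDist x (C i) ^ θ with hs
  have hterm : ∀ i, 0 ≤ infDist x (C i) ^ θ := fun i => Real.rpow_nonneg infDist_nonneg _
  have hs0 : 0 ≤ s := Finset.sum_nonneg fun i _ => hterm i
  have hsR : s ≤ m * R ^ θ := by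
    have : ∀ i ∈ Finset.univ, infDist x (C i) ^ θ ≤ R ^ θ := fun i _ =>
      Real.rpow_le_rpow infDist_nonneg ((infDist_le_dist_of_mem (haC i)).trans
        (dist_eq_norm x a ▸ hKR x hx)) hθ.le
    simpa using Finset.sum_le_card_nsmul _ _ _ this
  set δ := s ^ (1 / (θ * (d : ℝ) ^ n)) with hδ
  have hδ0 : 0 ≤ δ := Real.rpow_nonneg hs0 _
  have hδN : δ ^ d ^ n = s ^ (1 / θ) := by
    rw [← Real.rpow_natCast, hδ, ← Real.rpow_mul hs0]
    congr 1
    push_cast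
    field_simp
  have hδθ : δ ^ θ = s ^ (1 / (d : ℝ) ^ n) := by
    rw [hδ, ← Real.rpow_mul hs0]
    congr 1
    field_simp
  have hdist := hbound x (hKR x hx) δ hδ0 fun i => by
    rw [hδN, one_div, Real.le_rpow_inv_iff_of_pos infDist_nonneg hs0 hθ]
    exact Finset.single_le_sum (fun i _ => hterm i) (Finset.mem_univ i)
  have hsplit : s ^ (1 / (d : ℝ) ^ n) ≤ (m * R ^ θ) ^ (1 / (d : ℝ) ^ n - τ) * s ^ τ := by
    rw [show 1 / (d : ℝ) ^ n = (1 / (d : ℝ) ^ n - τ) + τ by ring,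
      Real.rpow_add_of_nonneg hs0 (by linarith) hτ0.le, add_sub_cancel_right]
    gcongr
  calc infDist x (⋂ i, C i) ^ θ ≤ (c * δ) ^ θ := Real.rpow_le_rpow infDist_nonneg hdist hθ.le
    _ = c ^ θ * s ^ (1 / (d : ℝ) ^ n) := by rw [Real.mul_rpow hc.le hδ0, hδθ]
    _ ≤ c ^ θ * ((m * R ^ θ) ^ (1 / (d : ℝ) ^ n - τ) * s ^ τ) := by gcongr
    _ = _ := by ring
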